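/- (Fixed point theorem for anti-attracting maps) Let Z be an affine subspace of ℝⁿ, K a compact convex subset of Z, x̃ ∈ int(K), and let φ : int(K) → int(K) be continuous. Suppose φ is anti-attracting: for every x̄ ∈ ∂K there is a neighborhood U of x̄ in Z such that φ(x) ∉ Ext(x) for all x ∈ U ∩ int(K), where Ext(x) = {x̃ + t(x - x̃) : t > 1}. Then φ has a fixed point in int(K). -/

import Mathlib

open Set Metric MeasureTheory Polynomial Topology
open scoped NNReal

/-- `det (1 + t A)` is a polynomial in `t` of degree at most the dimension of the space. -/
theorem ContinuousLinearMap.exists_polynomial_eval_eq_det_one_add_smul {E : Type*}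
    [NormedAddCommGroup E] [NormedSpace ℝ E] [FiniteDimensional ℝ E] (A : E →L[ℝ] E) :
    ∃ p : ℝ[X], p.degree < (Module.finrank ℝ E + 1 : ℕ) ∧
      ∀ t : ℝ, p.eval t = (ContinuousLinearMap.id ℝ E + t • A).det := by
  let b := Module.finBasis ℝ E
  let M := LinearMap.toMatrix b b (A : E →ₗ[ℝ] E)
  refine ⟨((X : ℝ[X]) • M.map C + (1 : Matrix _ _ ℝ).map C).det, ?_, fun t => ?_⟩
  · refine (Polynomial.degree_le_natDegree).trans_lt ?_
    have := Polynomial.natDegree_det_X_add_C_le M 1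
    simp only [Fintype.card_fin] at this
    exact_mod_cast Nat.lt_succ_of_le this
  · have hdet : (ContinuousLinearMap.id ℝ E + t • A).det = (1 + t • M).det := by
      rw [ContinuousLinearMap.det, ← LinearMap.det_toMatrix b]
      simp [M]
    rw [hdet, ← Polynomial.coe_evalRingHom, RingHom.map_det]
    congr 1
    ext i j
    by_cases hij : i = j <;> simp [hij, add_comm, mul_comm t]

/-- By Lagrange interpolation, `det (1 + A)` is a fixed affine combination of the values
`det (1 + v i A)` at nodes `v i` in a prescribed interval `(0, ε)`. -/
theorem ContinuousLinearMap.exists_weights_det_id_add_eq_sum (E : Type*)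
    [NormedAddCommGroup E] [NormedSpace ℝ E] [FiniteDimensional ℝ E] {ε : ℝ} (hε : 0 < ε) :
    ∃ (s : Finset ℕ) (v w : ℕ → ℝ), (∀ i, 0 < v i ∧ v i < ε) ∧ ∑ i ∈ s, w i = 1 ∧
      ∀ A : E →L[ℝ] E, (ContinuousLinearMap.id ℝ E + A).det =
        ∑ i ∈ s, w i * (ContinuousLinearMap.id ℝ E + v i • A).det := by
  let s := Finset.range (Module.finrank ℝ E + 1)
  let v : ℕ → ℝ := fun i => ε / (i + 2)
  have hv : Function.Injective v := by
    intro i j h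
    have h2 : (i : ℝ) + 2 ≠ 0 := by positivity
    have h3 : (j : ℝ) + 2 ≠ 0 := by positivity
    simp only [v] at h
    field_simp at h
    exact_mod_cast (by linarith : (i : ℝ) = j)
  refine ⟨s, v, fun i => (Lagrange.basis s v i).eval 1, fun i => ⟨by positivity, ?_⟩, ?_, ?_⟩
  · have h2 : (0 : ℝ) ≤ i := by positivity
    rw [div_lt_iff₀ (by positivity)]
    nlinarith
  · rw [← Polynomial.eval_finsetSum, Lagrange.sum_basis hv.injOn (by simp [s])]
    simp
  · intro A
    obtain ⟨p, hp, hpe⟩ := A.exists_polynomial_eval_eq_det_one_add_smul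
    have h := Lagrange.eq_interpolate (s := s) (v := v) hv.injOn (f := p) (by simpa [s] using hp)
    have h1 := hpe 1
    rw [one_smul] at h1
    rw [← h1, h, Lagrange.interpolate_apply, Polynomial.eval_finsetSum]
    refine Finset.sum_congr rfl fun i _ => ?_
    rw [Polynomial.eval_mul, Polynomial.eval_C, hpe, mul_comm]

/-- For a self-map `r` of a closed ball that fixes the boundary sphere, with `r - id` Lipschitz, the map
`x ↦ x + t (r x - x)` is a bijection of the ball for small `t`. -/
theorem injOn_and_image_closedBall_add_smul_sub {E : Type*}
    [NormedAddCommGroup E] [NormedSpace ℝ E] [FiniteDimensional ℝ E] [Nontrivial E]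
    {r : E → E} {R : ℝ} (hR : 0 < R) {C : ℝ≥0}
    (hmaps : ∀ x ∈ closedBall (0 : E) R, r x ∈ closedBall (0 : E) R)
    (hfix : ∀ x ∈ sphere (0 : E) R, r x = x)
    (hlip : LipschitzOnWith C (fun x => r x - x) (closedBall 0 R))
    {t : ℝ} (ht0 : 0 ≤ t) (ht1 : t < 1) (htC : t * C < 1) :
    InjOn (fun x => x + t • (r x - x)) (closedBall 0 R) ∧
      (fun x => x + t • (r x - x)) '' closedBall 0 R = closedBall 0 R := by
  have : CompleteSpace E := FiniteDimensional.complete ℝ E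
  have : ProperSpace E := FiniteDimensional.proper ℝ E
  set f : E → E := fun x => x + t • (r x - x) with hf
  let c : ℝ≥0 := t.toNNReal * C
  have hcval : (c : ℝ) = t * C := by simp [c, ht0]
  have happ : ApproximatesLinearOn f (ContinuousLinearEquiv.refl ℝ E : E →L[ℝ] E)
      (closedBall 0 R) c := by
    intro x hx y hy
    have h := hlip.norm_sub_le hx hy
    have e : f x - f y - (ContinuousLinearEquiv.refl ℝ E : E →L[ℝ] E) (x - y) =
        t • ((r x - x) - (r y - y)) := by
      simp only [hf, ContinuousLinearEquiv.coe_refl, ContinuousLinearMap.id_apply, smul_sub]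
      abel
    rw [e, norm_smul, Real.norm_of_nonneg ht0]
    calc t * ‖r x - x - (r y - y)‖ ≤ t * (C * ‖x - y‖) := by gcongr
      _ = c * ‖x - y‖ := by rw [hcval, mul_assoc]
  have hc : c < ‖((ContinuousLinearEquiv.refl ℝ E).symm : E →L[ℝ] E)‖₊⁻¹ := by
    have h1 : ‖((ContinuousLinearEquiv.refl ℝ E).symm : E →L[ℝ] E)‖₊ = 1 := by
      simp
    rw [h1, inv_one, ← NNReal.coe_lt_coe]
    simpa [hcval] using htC
  have hval : ∀ x, f x = (1 - t) • x + t • r x := fun x => by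
    simp only [hf]; module
  have hball : ∀ x ∈ ball (0 : E) R, f x ∈ ball (0 : E) R := by
    intro x hx
    have hrx := hmaps x (ball_subset_closedBall hx)
    rw [mem_ball_zero_iff] at hx ⊢
    rw [mem_closedBall_zero_iff] at hrx
    rw [hval]
    refine (norm_add_le _ _).trans_lt ?_
    rw [norm_smul, norm_smul, Real.norm_of_nonneg ht0, Real.norm_of_nonneg (by linarith)]
    nlinarith
  have hsph : ∀ x ∈ sphere (0 : E) R, f x = x := fun x hx => by simp [hf, hfix x hx]
  refine ⟨happ.injOn (Or.inr hc), Subset.antisymm ?_ ?_⟩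
  · rintro _ ⟨x, hx, rfl⟩
    rw [← ball_union_sphere] at hx
    rcases hx with hx | hx
    · exact ball_subset_closedBall (hball x hx)
    · rw [hsph x hx]; exact sphere_subset_closedBall hx
  · have hopen : IsOpen (f '' ball 0 R) :=
      (happ.mono_set ball_subset_closedBall).open_image
        (ContinuousLinearEquiv.refl ℝ E).toNonlinearRightInverse isOpen_ball (Or.inr hc)
    have hclosed : IsClosed (f '' closedBall 0 R) :=
      ((isCompact_closedBall (0 : E) R).image_of_continuousOn happ.continuousOn).isClosed
    have hsub : ball (0 : E) R ⊆ f '' ball 0 R := by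
      refine (convex_ball (0 : E) R).isPreconnected.subset_of_closure_inter_subset hopen
        ⟨f 0, hball 0 (mem_ball_self hR), mem_image_of_mem f (mem_ball_self hR)⟩ ?_
      rintro y ⟨hy, hyR⟩
      obtain ⟨x, hx, rfl⟩ := closure_minimal (image_mono ball_subset_closedBall) hclosed hy
      rw [← ball_union_sphere] at hx
      rcases hx with hx | hx
      · exact mem_image_of_mem f hx
      · rw [hsph x hx, mem_ball_zero_iff] at hyR
        rw [mem_sphere_zero_iff_norm] at hx
        exact absurd hx hyR.ne
    intro y hy
    rw [← ball_union_sphere] at hy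
    rcases hy with hy | hy
    · exact image_mono ball_subset_closedBall (hsub hy)
    · exact ⟨y, sphere_subset_closedBall hy, hsph y hy⟩

/-- A differentiable map of constant nonzero norm has singular derivative. -/
theorem det_fderiv_eq_zero_of_norm_eq {E : Type*} [NormedAddCommGroup E] [InnerProductSpace ℝ E]
    [FiniteDimensional ℝ E] {r : E → E} {R : ℝ} (hR : 0 < R) (hnorm : ∀ x, ‖r x‖ = R) {x : E}
    (hr : DifferentiableAt ℝ r x) : (fderiv ℝ r x).det = 0 := by
  by_contra h
  have hsurj : Function.Surjective (fderiv ℝ r x) :=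
    (LinearMap.equivOfDetNeZero (fderiv ℝ r x : E →ₗ[ℝ] E) h).surjective
  obtain ⟨v, hv⟩ := hsurj (r x)
  have h1 := hr.hasFDerivAt.norm_sq
  have h2 : HasFDerivAt (fun y => ‖r y‖ ^ 2) (0 : E →L[ℝ] ℝ) x := by
    simp only [hnorm]
    exact hasFDerivAt_const _ _
  have h3 := congrArg (fun L : E →L[ℝ] ℝ => L v) (h1.unique h2)
  simp [hv, hnorm, hR.ne'] at h3

/-- There is no `C¹` retraction onto a sphere. -/
theorem not_exists_contDiff_retraction_sphere {E : Type*} [NormedAddCommGroup E]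
    [InnerProductSpace ℝ E] [FiniteDimensional ℝ E] {r : E → E} {R : ℝ} (hR : 0 < R)
    (hr : ContDiff ℝ 1 r) (hnorm : ∀ x, ‖r x‖ = R) (hfix : ∀ x ∈ sphere (0 : E) R, r x = x) :
    False := by
  have : ProperSpace E := FiniteDimensional.proper ℝ E
  have : Nontrivial E := ⟨r 0, 0, by rw [← norm_pos_iff, hnorm]; exact hR⟩
  borelize E
  let μ : Measure E := Measure.addHaar
  set B := closedBall (0 : E) R with hB
  have hBc : IsCompact B := isCompact_closedBall 0 R
  let g : E → E := fun x => r x - x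
  have hg : ContDiff ℝ 1 g := hr.sub contDiff_id
  have hgd : Differentiable ℝ g := hg.differentiable one_ne_zero
  have hg' : Continuous (fderiv ℝ g) := hg.continuous_fderiv one_ne_zero
  obtain ⟨M, hM⟩ := hBc.exists_bound_of_continuousOn hg'.continuousOn
  let C : ℝ≥0 := M.toNNReal
  have hC : ∀ x ∈ B, ‖fderiv ℝ g x‖ ≤ C := fun x hx => (hM x hx).trans (Real.le_coe_toNNReal M)
  have hlip : LipschitzOnWith C g B :=
    (convex_closedBall 0 R).lipschitzOnWith_of_nnnorm_fderiv_le (fun x _ => hgd x)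
      (fun x hx => by exact_mod_cast hC x hx)
  obtain ⟨η, hη, hdet⟩ : ∃ η > 0, ∀ A : E →L[ℝ] E, ‖A‖ < η →
      0 < (ContinuousLinearMap.id ℝ E + A).det := by
    have hcont : Continuous fun A : E →L[ℝ] E => (ContinuousLinearMap.id ℝ E + A).det :=
      ContinuousLinearMap.continuous_det.comp (continuous_const.add continuous_id)
    have h0 : 0 < (ContinuousLinearMap.id ℝ E + (0 : E →L[ℝ] E)).det := by
      simp [ContinuousLinearMap.det]
    obtain ⟨η, hη, h⟩ := Metric.mem_nhds_iff.1 (hcont.continuousAt.eventually_const_lt h0)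
    exact ⟨η, hη, fun A hA => h (by simpa using hA)⟩
  let ε : ℝ := min 1 η / (C + 1)
  have hε : 0 < ε := by positivity
  have hvol : ∀ t, 0 < t → t < ε →
      ∫ x in B, (ContinuousLinearMap.id ℝ E + t • fderiv ℝ g x).det ∂μ = μ.real B := by
    intro t ht0 htε
    have hC0 : (0 : ℝ) ≤ C := C.2
    have h1 : t * (C + 1) < min 1 η := (lt_div_iff₀ (by positivity)).1 htε
    have h2 := h1.trans_le (min_le_left _ _)
    have h3 := h1.trans_le (min_le_right _ _)
    obtain ⟨hinj, himg⟩ := injOn_and_image_closedBall_add_smul_sub hR (C := C)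
      (fun x _ => by simp [hnorm x]) hfix hlip ht0.le (by nlinarith) (by nlinarith)
    have hder : ∀ x ∈ B, HasFDerivWithinAt (fun x => x + t • (r x - x))
        (ContinuousLinearMap.id ℝ E + t • fderiv ℝ g x) B x := fun x _ =>
      ((hasFDerivAt_id x).add ((hgd x).hasFDerivAt.const_smul t)).hasFDerivWithinAt
    have hlint := lintegral_abs_det_fderiv_eq_addHaar_image μ isClosed_closedBall.measurableSet
      hder hinj
    have hpos : ∀ x ∈ B, 0 < (ContinuousLinearMap.id ℝ E + t • fderiv ℝ g x).det := by
      intro x hx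
      refine hdet _ ?_
      rw [norm_smul, Real.norm_of_nonneg ht0.le]
      have := mul_le_mul_of_nonneg_left (hC x hx) ht0.le
      nlinarith
    rw [himg, setLIntegral_congr_fun isClosed_closedBall.measurableSet
      (fun x hx => by rw [abs_of_pos (hpos x hx)])] at hlint
    rw [integral_eq_lintegral_of_nonneg_ae, hlint, Measure.real]
    · exact (ae_restrict_iff' isClosed_closedBall.measurableSet).2
        (Filter.Eventually.of_forall fun x hx => (hpos x hx).le)
    · exact (ContinuousLinearMap.continuous_det.comp
        (continuous_const.add (hg'.const_smul t))).aestronglyMeasurable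
  obtain ⟨s, v, w, hv, hw, hsum⟩ := ContinuousLinearMap.exists_weights_det_id_add_eq_sum E hε
  have hzero : ∀ x, ∑ i ∈ s, w i * (ContinuousLinearMap.id ℝ E + v i • fderiv ℝ g x).det = 0 := by
    intro x
    rw [← hsum, ← det_fderiv_eq_zero_of_norm_eq hR hnorm (hr.differentiable one_ne_zero x)]
    congr 1
    have : fderiv ℝ g x = fderiv ℝ r x - ContinuousLinearMap.id ℝ E :=
      ((hr.differentiable one_ne_zero x).hasFDerivAt.sub (hasFDerivAt_id x)).fderiv
    rw [this]
    abel
  have hint : ∀ i ∈ s, Integrable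
      (fun x => w i * (ContinuousLinearMap.id ℝ E + v i • fderiv ℝ g x).det) (μ.restrict B) :=
    fun i _ => ((continuous_const.mul (ContinuousLinearMap.continuous_det.comp
      (continuous_const.add (hg'.const_smul (v i))))).continuousOn.integrableOn_compact hBc)
  have hfinal := integral_finsetSum s hint
  simp only [hzero, integral_zero, integral_const_mul] at hfinal
  rw [Finset.sum_congr rfl fun i _ => by rw [hvol (v i) (hv i).1 (hv i).2], ← Finset.sum_mul, hw,
    one_mul] at hfinal
  have hpos : 0 < μ.real B :=
    ENNReal.toReal_pos (measure_closedBall_pos μ 0 hR).ne' hBc.measure_lt_top.ne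
  exact hpos.ne hfinal

/-- **Brouwer fixed point theorem** for bounded continuous self-maps of a finite-dimensional space. -/
theorem exists_fixedPt_of_continuous_of_norm_le {E : Type*} [NormedAddCommGroup E]
    [InnerProductSpace ℝ E] [FiniteDimensional ℝ E] {f : E → E} (hf : Continuous f) {M : ℝ}
    (hM : 0 < M) (hbound : ∀ x, ‖f x‖ ≤ M) : ∃ x, f x = x := by
  by_contra! hne
  obtain ⟨g, hg⟩ := exists_contMDiffMap_forall_mem_convex_of_local_const (n := 1)
    (modelWithCornersSelf ℝ E) (t := fun x => closedBall (0 : E) M ∩ ball (f x) (dist (f x) x))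
    (fun x => (convex_closedBall _ _).inter (convex_ball _ _)) (fun x => by
      refine ⟨f x, ?_⟩
      have h1 : Continuous fun y => dist (f x) (f y) := continuous_const.dist hf
      have h2 : Continuous fun y => dist (f y) y := hf.dist continuous_id
      have h3 : dist (f x) (f x) < dist (f x) x := by
        rw [dist_self]; exact dist_pos.2 (hne x)
      filter_upwards [h1.continuousAt.eventually_lt h2.continuousAt h3] with y hy
      exact ⟨by simpa using hbound x, hy⟩)
  have hgd : ContDiff ℝ 1 g := g.contMDiff.contDiff
  have hgne : ∀ x, g x ≠ x := fun x hx => by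
    have := (hg x).2
    rw [hx, mem_ball, dist_comm] at this
    exact lt_irrefl _ this
  have hgM : ∀ x, ‖g x‖ ≤ M := fun x => by simpa using (hg x).1
  let χ : ContDiffBump (0 : E) := ⟨M, 2 * M, hM, by linarith⟩
  let F : E → E := fun x => x - χ x • g x
  have hFd : ContDiff ℝ 1 F := contDiff_id.sub (χ.contDiff.smul hgd)
  have hF0 : ∀ x, F x ≠ 0 := by
    intro x hx
    have hx' : x = χ x • g x := sub_eq_zero.1 hx
    by_cases hxM : ‖x‖ ≤ M
    · rw [χ.one_of_mem_closedBall (by simpa using hxM), one_smul] at hx'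
      exact hgne x hx'.symm
    · refine hxM ?_
      rw [hx', norm_smul, Real.norm_of_nonneg χ.nonneg]
      calc χ x * ‖g x‖ ≤ 1 * M := mul_le_mul χ.le_one (hgM x) (norm_nonneg _) zero_le_one
        _ = M := one_mul M
  have h2M : 0 < 2 * M := by linarith
  refine not_exists_contDiff_retraction_sphere (r := fun x => (2 * M * ‖F x‖⁻¹) • F x) h2M
    ((contDiff_const.mul ((hFd.norm ℝ hF0).inv fun x => norm_ne_zero_iff.2 (hF0 x))).smul hFd)
    (fun x => ?_) (fun x hx => ?_)
  · have := norm_pos_iff.2 (hF0 x)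
    rw [norm_smul, Real.norm_of_nonneg (by positivity)]
    field_simp
  · rw [mem_sphere_zero_iff_norm] at hx
    have hFx : F x = x := by
      simp only [F]
      rw [χ.zero_of_le_dist (by simp [χ, hx]), zero_smul, sub_zero]
    simp only [hFx, hx]
    rw [mul_inv_cancel₀ h2M.ne', one_smul]

/-- The fixed point theorem for anti-attracting maps on a convex body in a Euclidean space, with the
origin as the distinguished interior point. -/
theorem exists_fixedPt_interior_of_anti_attracting_zero {E : Type*} [NormedAddCommGroup E]
    [InnerProductSpace ℝ E] [FiniteDimensional ℝ E] {K : Set E} (hK : IsCompact K)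
    (hconv : Convex ℝ K) (h0 : (0 : E) ∈ interior K) {φ : E → E}
    (hφc : ContinuousOn φ (interior K))
    (hφ : ∀ y ∈ frontier K, ∃ U, IsOpen U ∧ y ∈ U ∧
      ∀ x ∈ U ∩ interior K, ¬ ∃ t : ℝ, 1 < t ∧ φ x = t • x) :
    ∃ x ∈ interior K, φ x = x := by
  have hnhds : K ∈ 𝓝 (0 : E) := mem_interior_iff_mem_nhds.1 h0
  have hint : ∀ {x}, gauge K x < 1 ↔ x ∈ interior K := gauge_lt_one_iff_mem_interior hconv hnhds
  have hpc : Continuous (gauge K) := continuous_gauge hconv hnhds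
  choose! U hUo hyU hU using hφ
  let W : Set E := ⋃ y ∈ frontier K, U y
  have hWo : IsOpen W := isOpen_biUnion hUo
  obtain ⟨s, hs0, hs1, hsW⟩ : ∃ s : ℝ, 0 < s ∧ s < 1 ∧
      ∀ x ∈ interior K, gauge K x = s → x ∈ W := by
    have hAc : IsCompact (K \ W) := hK.diff hWo
    have hA : ∀ x ∈ K \ W, gauge K x < 1 := fun x hx => hint.2 <| by
      by_contra hxi
      have hxf : x ∈ frontier K := ⟨subset_closure hx.1, hxi⟩
      exact hx.2 (mem_biUnion hxf (hyU x hxf))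
    have key : ∃ m : ℝ, m < 1 ∧ ∀ x ∈ K \ W, gauge K x ≤ m := by
      rcases (K \ W).eq_empty_or_nonempty with he | hne
      · exact ⟨0, one_pos, by simp [he]⟩
      · obtain ⟨x, hx, hmax⟩ := hAc.exists_isMaxOn hne hpc.continuousOn
        exact ⟨gauge K x, hA x hx, fun y hy => hmax hy⟩
    obtain ⟨m, hm1, hm⟩ := key
    obtain ⟨s, hs, hs1⟩ := exists_between (max_lt hm1 one_pos)
    rw [max_lt_iff] at hs
    refine ⟨s, hs.2, hs1, fun x hx hxs => ?_⟩
    by_contra hxW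
    linarith [hm x ⟨interior_subset hx, hxW⟩]
  let ρ : E → E := fun x => (max 1 (gauge K x / s))⁻¹ • x
  have hmaxpos : ∀ x, 0 < max 1 (gauge K x / s) := fun x => lt_max_of_lt_left one_pos
  have hρc : Continuous ρ :=
    ((continuous_const.max (hpc.div_const s)).inv₀ fun x => (hmaxpos x).ne').smul continuous_id
  have hρle : ∀ x, gauge K (ρ x) ≤ s := by
    intro x
    simp only [ρ]
    rw [gauge_smul_of_nonneg (inv_nonneg.2 (hmaxpos x).le), smul_eq_mul,
      inv_mul_le_iff₀ (hmaxpos x), ← div_le_iff₀ hs0]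
    exact le_max_right _ _
  have hρint : ∀ x, ρ x ∈ interior K := fun x => hint.1 ((hρle x).trans_lt hs1)
  have hρid : ∀ x, gauge K x ≤ s → ρ x = x := fun x hx => by
    simp only [ρ]
    rw [max_eq_left ((div_le_one hs0).2 hx), inv_one, one_smul]
  obtain ⟨M, hM⟩ := hK.isBounded.exists_norm_le
  obtain ⟨x, hx⟩ := exists_fixedPt_of_continuous_of_norm_le
    (f := fun x => ρ (φ (ρ x))) (M := max M 1)
    (hρc.comp (hφc.comp_continuous hρc hρint)) (by positivity)
    (fun x => (hM _ (interior_subset (hρint _))).trans (le_max_left _ _))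
  have hxs : gauge K x ≤ s := hx ▸ hρle _
  have hxint : x ∈ interior K := hint.1 (hxs.trans_lt hs1)
  simp only [hρid x hxs] at hx
  refine ⟨x, hxint, ?_⟩
  rcases le_or_gt (gauge K (φ x)) s with hle | hgt
  · rwa [hρid _ hle] at hx
  · have ht : 1 < gauge K (φ x) / s := (one_lt_div hs0).2 hgt
    have ht0 : 0 < gauge K (φ x) / s := one_pos.trans ht
    have hx' : x = (gauge K (φ x) / s)⁻¹ • φ x := by
      conv_lhs => rw [← hx]
      simp only [ρ]
      rw [max_eq_right ht.le]
    have hφx : φ x = (gauge K (φ x) / s) • x := (eq_inv_smul_iff₀ ht0.ne').1 hx' |>.symm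
    have hgx : gauge K x = s := by
      have h := congrArg (gauge K) hφx
      rw [gauge_smul_of_nonneg ht0.le, smul_eq_mul] at h
      have hpos : gauge K (φ x) ≠ 0 := (hs0.trans hgt).ne'
      field_simp at h
      linarith
    obtain ⟨y, hy, hxy⟩ := mem_iUnion₂.1 (hsW x hxint hgx)
    exact absurd ⟨_, ht, hφx⟩ (hU y hy x ⟨hxy, hxint⟩)

/-- Theorem 3.2: An anti-attracting continuous map
`φ : int K → int K` has a fixed point in `int K`. Anti-attracting means: for
every `x̄ ∈ ∂K` there is a neighborhood `U` of `x̄` in `Z` such that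
`φ(x) ∉ Ext(x)` for all `x ∈ U ∩ int K`. -/
theorem fixed_point_of_anti_attracting_map
    (n : ℕ) (Z : AffineSubspace ℝ (Fin n → ℝ))
    (K : Set Z) (hKc : IsCompact K) (hKconv : Convex ℝ (Subtype.val '' K))
    (xt : Z) (hxt : xt ∈ interior K)
    (φ : Z → Z) (hφc : ContinuousOn φ (interior K))
    (hφmaps : Set.MapsTo φ (interior K) (interior K))
    (hφ : ∀ xb : Z, xb ∈ frontier K → ∃ U : Set Z, IsOpen U ∧ xb ∈ U ∧
      ∀ x ∈ U ∩ interior K,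
        ¬ ∃ t : ℝ, 1 < t ∧
          (φ x : Fin n → ℝ) = (xt : Fin n → ℝ) + t • ((x : Fin n → ℝ) - (xt : Fin n → ℝ))) :
    ∃ x ∈ interior K, φ x = x := by
  have : Nonempty Z := ⟨xt⟩
  let E := EuclideanSpace ℝ (Fin (Module.finrank ℝ Z.direction))
  let e : E ≃L[ℝ] Z.direction := ContinuousLinearEquiv.ofFinrankEq (by simp [E])
  let ψ : E ≃ₜ Z := e.toHomeomorph.trans (IsometryEquiv.vaddConst xt).toHomeomorph
  have hψ : ∀ v, (ψ v : Fin n → ℝ) = (e v : Fin n → ℝ) + xt := fun v => rfl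
  have hψ0 : ψ 0 = xt := Subtype.ext (by simp [hψ])
  have hKint : interior (ψ ⁻¹' K) = ψ ⁻¹' interior K := (ψ.preimage_interior K).symm
  have hKfr : frontier (ψ ⁻¹' K) = ψ ⁻¹' frontier K := (ψ.preimage_frontier K).symm
  have hconv : Convex ℝ (ψ ⁻¹' K) := by
    intro v hv w hw a b ha hb hab
    obtain ⟨z, hz, hzv⟩ := hKconv (mem_image_of_mem _ hv) (mem_image_of_mem _ hw) ha hb hab
    have : ψ (a • v + b • w) = z := by
      refine Subtype.ext ?_
      rw [hzv, hψ, hψ, hψ, map_add, map_smul, map_smul]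
      simp only [Submodule.coe_add, Submodule.coe_smul, smul_add]
      have : (xt : Fin n → ℝ) = a • (xt : Fin n → ℝ) + b • (xt : Fin n → ℝ) := by
        rw [← add_smul, hab, one_smul]
      nth_rewrite 1 [this]
      abel
    rwa [mem_preimage, this]
  obtain ⟨v, hv, hfix⟩ := exists_fixedPt_interior_of_anti_attracting_zero
    (K := ψ ⁻¹' K) (φ := ψ.symm ∘ φ ∘ ψ) (ψ.isCompact_preimage.2 hKc) hconv
    (by rwa [hKint, mem_preimage, hψ0])
    (by
      rw [hKint]
      exact ψ.symm.continuous.comp_continuousOn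
        (hφc.comp ψ.continuous.continuousOn (mapsTo_preimage _ _)))
    (by
      rw [hKint, hKfr]
      intro y hy
      obtain ⟨U, hUo, hyU, hU⟩ := hφ (ψ y) hy
      refine ⟨ψ ⁻¹' U, hUo.preimage ψ.continuous, hyU, ?_⟩
      rintro v hv ⟨t, ht, hvt⟩
      refine hU (ψ v) hv ⟨t, ht, ?_⟩
      have h : φ (ψ v) = ψ (t • v) := by rw [← hvt]; simp
      rw [h, hψ, hψ, map_smul, Submodule.coe_smul]
      simp [add_comm])
  rw [hKint] at hv
  exact ⟨ψ v, hv, by simpa [ψ.symm_apply_eq] using hfix⟩
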